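/- Fix an integer k > 1 and a real number β with 0 < β < 1. Then there exists N = N(k,β) such that for all n > N the following holds: for every proper coloring of the stable Kneser graph SKn_{n,k} using at most n−2k+1 colors (i.e., every assignment of one of n−2k+1 colors to each stable k-subset of {1,…,n} such that any two disjoint stable k-subsets receive different colors), at least nβ/k of the nonempty color classes are star-shaped. -/

import Mathlib

/-- A subset `A` of `{1,…,n}` is *stable* if it contains no two cyclically
consecutive elements: no `i < n` with both `i` and `i+1` in `A`, and not both
`n` and `1` in `A`. -/
def IsStable (n : ℕ) (A : Finset ℕ) : Prop :=
  (∀ i < n, ¬(i ∈ A ∧ i + 1 ∈ A)) ∧ ¬(n ∈ A ∧ 1 ∈ A)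

instance (n : ℕ) (A : Finset ℕ) : Decidable (IsStable n A) := by
  unfold IsStable; infer_instance

/-- The collection of stable `k`-element subsets of `{1,…,n}`, i.e. the
vertices of the stable Kneser graph `SKn_{n,k}`. -/
def stableSets (n k : ℕ) : Finset (Finset ℕ) :=
  (Finset.Icc 1 n).powerset.filter fun A => A.card = k ∧ IsStable n A

/-- The number of `k`-subsets of `s` containing a fixed subset `t`. -/
lemma Finset.card_filter_subset_powersetCard_le {α : Type*} [DecidableEq α] (s t : Finset α)
    (k : ℕ) :
    ((s.powersetCard k).filter fun A => t ⊆ A).card ≤ (s.card - t.card).choose (k - t.card) := by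
  by_cases hts : t ⊆ s
  · rw [← Finset.card_sdiff_of_subset hts, ← Finset.card_powersetCard]
    refine Finset.card_le_card_of_injOn (fun A => A \ t) ?_ ?_
    · intro A hA
      simp only [Finset.coe_filter, Set.mem_ofPred_eq, Finset.mem_powersetCard] at hA
      obtain ⟨⟨hAs, hAk⟩, htA⟩ := hA
      simp only [Finset.mem_coe, Finset.mem_powersetCard]
      exact ⟨Finset.sdiff_subset_sdiff hAs le_rfl, by
        rw [Finset.card_sdiff_of_subset htA, hAk]⟩
    · intro A hA B hB hAB
      simp only [Finset.coe_filter, Set.mem_ofPred_eq] at hA hB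
      rw [← Finset.sdiff_union_of_subset hA.2, ← Finset.sdiff_union_of_subset hB.2]
      exact congrArg (· ∪ t) hAB
  · rw [Finset.filter_false_of_mem, Finset.card_empty]
    · exact Nat.zero_le _
    · intro A hA htA
      exact hts (htA.trans (Finset.mem_powersetCard.1 hA).1)

/-- The number of `k`-subsets of `s` containing two fixed distinct elements. -/
lemma Finset.card_filter_pair_subset_powersetCard_le {α : Type*} [DecidableEq α] (s : Finset α)
    {a b : α} (hab : a ≠ b) (k : ℕ) :
    ((s.powersetCard k).filter fun A => {a, b} ⊆ A).card ≤ (s.card - 2).choose (k - 2) := by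
  have h := Finset.card_filter_subset_powersetCard_le s {a, b} k
  rwa [Finset.card_pair hab] at h

/-- A star-shaped family of `k`-subsets of `s` has at most `(#s - 1).choose (k - 1)` members. -/
lemma Finset.card_le_choose_of_forall_mem {α : Type*} [DecidableEq α] {s : Finset α}
    {F : Finset (Finset α)} {k : ℕ} (hF : F ⊆ s.powersetCard k) {x : α}
    (hx : ∀ A ∈ F, x ∈ A) : F.card ≤ (s.card - 1).choose (k - 1) := by
  have h := Finset.card_filter_subset_powersetCard_le s {x} k
  rw [Finset.card_singleton] at h
  refine (Finset.card_le_card fun A hA => ?_).trans h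
  simpa [Finset.mem_filter, hx A hA] using Finset.mem_powersetCard.1 (hF hA)

/-- An intersecting family of `k`-subsets of `s` that is not star-shaped has at most
`k * k * (#s - 2).choose (k - 2)` members. -/
lemma Finset.card_le_of_intersecting_of_forall_exists_notMem {α : Type*} [DecidableEq α]
    {s : Finset α} {F : Finset (Finset α)} {k : ℕ} (hF : F ⊆ s.powersetCard k)
    (hint : ∀ A ∈ F, ∀ B ∈ F, ¬Disjoint A B) (hstar : ∀ x ∈ s, ∃ A ∈ F, x ∉ A) :
    F.card ≤ k * (k * (s.card - 2).choose (k - 2)) := by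
  obtain rfl | ⟨A, hA⟩ := F.eq_empty_or_nonempty
  · simp
  have hAs := Finset.mem_powersetCard.1 (hF hA)
  have hstar' : ∀ x, ∃ B, x ∈ s → B ∈ F ∧ x ∉ B := fun x => by
    by_cases hx : x ∈ s
    · obtain ⟨B, hB⟩ := hstar x hx
      exact ⟨B, fun _ => hB⟩
    · exact ⟨∅, fun h => absurd h hx⟩
  choose B hB using hstar'
  have hcover : F ⊆ A.biUnion fun a => (B a).biUnion fun b =>
      (s.powersetCard k).filter fun C => {a, b} ⊆ C := by
    intro C hC
    obtain ⟨a, haC, haA⟩ := Finset.not_disjoint_iff.1 (hint C hC A hA)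
    obtain ⟨b, hbC, hbB⟩ := Finset.not_disjoint_iff.1 (hint C hC (B a) (hB a (hAs.1 haA)).1)
    simp only [Finset.mem_biUnion, Finset.mem_filter]
    exact ⟨a, haA, b, hbB, hF hC, by simp [Finset.insert_subset_iff, haC, hbC]⟩
  refine (Finset.card_le_card hcover).trans ?_
  rw [← hAs.2]
  refine Finset.card_biUnion_le_card_mul _ _ _ fun a ha => ?_
  obtain ⟨hBF, haB⟩ := hB a (hAs.1 ha)
  rw [hAs.2]
  nth_rewrite 2 [← (Finset.mem_powersetCard.1 (hF hBF)).2]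
  refine Finset.card_biUnion_le_card_mul _ _ _ fun b hb => ?_
  exact Finset.card_filter_pair_subset_powersetCard_le s (ne_of_mem_of_not_mem hb haB).symm k

lemma stableSets_subset_powersetCard (n k : ℕ) :
    stableSets n k ⊆ (Finset.Icc 1 n).powersetCard k := by
  intro A hA
  simp only [stableSets, Finset.mem_filter, Finset.mem_powerset] at hA
  exact Finset.mem_powersetCard.2 ⟨hA.1, hA.2.1⟩

/-- All but at most `n * (n - 2).choose (k - 2)` of the `k`-subsets of `{1,…,n}` are stable. -/
lemma choose_le_card_stableSets_add {n k : ℕ} (hn : 2 ≤ n) :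
    n.choose k ≤ (stableSets n k).card + n * (n - 2).choose (k - 2) := by
  have hcover : (Finset.Icc 1 n).powersetCard k ⊆ stableSets n k ∪
      (Finset.Icc 1 n).biUnion fun i => ((Finset.Icc 1 n).powersetCard k).filter
        fun C => {i, if i = n then 1 else i + 1} ⊆ C := by
    intro A hA
    have hA' := Finset.mem_powersetCard.1 hA
    rw [Finset.mem_union]
    by_cases hst : IsStable n A
    · left
      simp only [stableSets, Finset.mem_filter, Finset.mem_powerset]
      exact ⟨hA'.1, hA'.2, hst⟩
    · right
      simp only [Finset.mem_biUnion, Finset.mem_filter, Finset.insert_subset_iff,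
        Finset.singleton_subset_iff]
      rw [IsStable, not_and_or] at hst
      rcases hst with h | h
      · push Not at h
        obtain ⟨i, hin, hi, hi1⟩ := h
        exact ⟨i, hA'.1 hi, hA, hi, by rwa [if_neg hin.ne]⟩
      · push Not at h
        exact ⟨n, hA'.1 h.1, hA, h.1, by simpa using h.2⟩
  have h := (Finset.card_le_card hcover).trans (Finset.card_union_le _ _)
  rw [Finset.card_powersetCard, Nat.card_Icc, Nat.add_sub_cancel] at h
  refine h.trans (Nat.add_le_add_left ?_ _)
  have hb := Finset.card_biUnion_le_card_mul (Finset.Icc 1 n)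
    (fun i => ((Finset.Icc 1 n).powersetCard k).filter
      fun C => {i, if i = n then 1 else i + 1} ⊆ C) ((n - 2).choose (k - 2)) fun i _ => by
    have hne : i ≠ if i = n then 1 else i + 1 := by split_ifs <;> omega
    simpa using Finset.card_filter_pair_subset_powersetCard_le (Finset.Icc 1 n) hne k
  simpa using hb

/-- The counting estimate behind the lower bound on the number `t` of star-shaped classes. -/
lemma div_le_of_choose_le {n k t : ℕ} (hk : 2 ≤ k) (hkn : k ≤ n)
    (h : n.choose k ≤ t * (n - 1).choose (k - 1) +
      n * (k * (k * (n - 2).choose (k - 2))) + n * (n - 2).choose (k - 2)) :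
    (n : ℝ) / k ≤ t + 2 * (k * k + 1) * k := by
  obtain ⟨m, rfl⟩ := Nat.exists_eq_add_of_le' hk
  obtain ⟨p, rfl⟩ := Nat.exists_eq_add_of_le' (hk.trans hkn)
  have h₀ := Nat.add_one_mul_choose_eq (p + 1) (m + 1)
  have h₁ := Nat.add_one_mul_choose_eq p m
  have hpos : 0 < (p + 1).choose (m + 1) := Nat.choose_pos (by omega)
  simp only [Nat.add_sub_cancel, show p + 2 - 1 = p + 1 by omega,
    show m + 2 - 1 = m + 1 by omega] at h
  generalize (p + 2).choose (m + 2) = C₀ at *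
  generalize (p + 1).choose (m + 1) = C₁ at *
  generalize p.choose m = C₂ at *
  have hC₂ : (p + 2) * C₂ ≤ 2 * ((m + 2) * C₁) := by nlinarith
  have hmain : (p + 2) * C₁ ≤ (t + 2 * ((m + 2) * (m + 2) + 1) * (m + 2)) * (m + 2) * C₁ := by
    calc (p + 2) * C₁ = C₀ * (m + 2) := h₀
      _ ≤ (t * C₁ + ((m + 2) * (m + 2) + 1) * ((p + 2) * C₂)) * (m + 2) :=
        Nat.mul_le_mul_right _ (h.trans (by ring_nf; rfl))
      _ ≤ (t * C₁ + ((m + 2) * (m + 2) + 1) * (2 * ((m + 2) * C₁))) * (m + 2) := by gcongr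
      _ = _ := by ring
  rw [div_le_iff₀ (by positivity)]
  exact_mod_cast Nat.le_of_mul_le_mul_right hmain hpos

open Classical in
theorem stmt5 (k : ℕ) (hk : 1 < k) (β : ℝ) (hβ0 : 0 < β) (hβ1 : β < 1) :
    ∃ N : ℕ, ∀ n : ℕ, N < n →
      ∀ c : Finset ℕ → Fin (n - 2 * k + 1),
        (∀ A ∈ stableSets n k, ∀ B ∈ stableSets n k, Disjoint A B → c A ≠ c B) →
        (n : ℝ) * β / k ≤
          (((Finset.univ : Finset (Fin (n - 2 * k + 1))).filter fun col =>
            ((stableSets n k).filter fun A => c A = col).Nonempty ∧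
              ∃ x ∈ Finset.Icc 1 n,
                ∀ A ∈ (stableSets n k).filter (fun A => c A = col), x ∈ A).card : ℝ) := by
  obtain ⟨M, hM⟩ := exists_nat_gt (2 * ((k : ℝ) * k + 1) * k * k / (1 - β))
  refine ⟨max M (2 * k), fun n hn c hc => ?_⟩
  obtain ⟨hnM, hnk⟩ := max_lt_iff.1 hn
  set stars := (Finset.univ : Finset (Fin (n - 2 * k + 1))).filter fun col =>
    ((stableSets n k).filter fun A => c A = col).Nonempty ∧
      ∃ x ∈ Finset.Icc 1 n, ∀ A ∈ (stableSets n k).filter (fun A => c A = col), x ∈ A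
  have hmem : ∀ col, col ∈ stars ↔ ((stableSets n k).filter fun A => c A = col).Nonempty ∧
      ∃ x ∈ Finset.Icc 1 n, ∀ A ∈ (stableSets n k).filter (fun A => c A = col), x ∈ A := by
    intro col
    simp only [stars, Finset.mem_filter, Finset.mem_univ, true_and]
  have hsub : ∀ col, (stableSets n k).filter (fun A => c A = col) ⊆
      (Finset.Icc 1 n).powersetCard k := fun col =>
    (Finset.filter_subset _ _).trans (stableSets_subset_powersetCard n k)
  have hstar : ∀ col ∈ stars, ((stableSets n k).filter fun A => c A = col).card ≤
      (n - 1).choose (k - 1) := by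
    intro col hcol
    obtain ⟨-, x, -, hx⟩ := (hmem col).1 hcol
    simpa using Finset.card_le_choose_of_forall_mem (hsub col) hx
  have hnonstar : ∀ col ∈ starsᶜ, ((stableSets n k).filter fun A => c A = col).card ≤
      k * (k * (n - 2).choose (k - 2)) := by
    intro col hcol
    obtain he | hne := ((stableSets n k).filter fun A => c A = col).eq_empty_or_nonempty
    · rw [he, Finset.card_empty]
      exact Nat.zero_le _
    have hno : ∀ x ∈ Finset.Icc 1 n,
        ∃ A ∈ (stableSets n k).filter (fun A => c A = col), x ∉ A := by
      intro x hx
      by_contra! hcon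
      exact Finset.mem_compl.1 hcol ((hmem col).2 ⟨hne, x, hx, hcon⟩)
    have hint : ∀ A ∈ (stableSets n k).filter (fun A => c A = col),
        ∀ B ∈ (stableSets n k).filter (fun A => c A = col), ¬Disjoint A B := by
      intro A hA B hB hAB
      rw [Finset.mem_filter] at hA hB
      exact hc A hA.1 B hB.1 hAB (hA.2.trans hB.2.symm)
    simpa using Finset.card_le_of_intersecting_of_forall_exists_notMem (hsub col) hint hno
  have hcount : (stableSets n k).card ≤
      stars.card * (n - 1).choose (k - 1) + n * (k * (k * (n - 2).choose (k - 2))) := by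
    rw [Finset.card_eq_sum_card_fiberwise (f := c) (t := Finset.univ) fun _ _ => by simp,
      ← Finset.sum_add_sum_compl stars]
    refine Nat.add_le_add (Finset.sum_le_card_nsmul _ _ _ hstar)
      ((Finset.sum_le_card_nsmul _ _ _ hnonstar).trans ?_)
    refine Nat.mul_le_mul_right _ ((Finset.card_le_univ _).trans ?_)
    rw [Fintype.card_fin]
    omega
  have hchoose := choose_le_card_stableSets_add (n := n) (k := k) (by omega)
  have hdiv := div_le_of_choose_le (n := n) (t := stars.card) hk (by omega)
    (hchoose.trans (Nat.add_le_add_right hcount _))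
  have hk0 : (0 : ℝ) < k := by positivity
  have hlarge : 2 * ((k : ℝ) * k + 1) * k * k < n * (1 - β) :=
    (div_lt_iff₀ (by linarith)).1 (hM.trans (by exact_mod_cast hnM))
  rw [div_le_iff₀ hk0] at hdiv ⊢
  linarith
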